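/- In the case where exactly one input sequence is eventually periodic, the output of the interleaving algorithm contains that input sequence in its entirety: every term a_{i_0,j} of the periodic input sequence appears (in order) in the output sequence. -/

import Mathlib

/-- the n-th triangular number -/
def tri (n : ℕ) : ℕ := n * (n + 1) / 2

/-- the diagonal index sequence `1, 2, 1, 2, 3, 1, 2, 3, 4, …` (for `k ≥ 1`):
`idx k = k − tri n + 1` for the unique `n` with `tri n ≤ k < tri (n+1)`. -/
def idx (k : ℕ) : ℕ := k - tri ((Nat.sqrt (8 * k + 1) - 1) / 2) + 1

/-- the minimal (finite) period of a list, if it has one -/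
def listPeriod? {X : Type*} [DecidableEq X] (L : List X) : Option ℕ :=
  (List.range L.length).find? fun k =>
    decide (0 < k) && (L.drop k == L.take (L.length - k))

/-- the block of length `n` following the cyclic repetition of the pattern `S`,
starting at phase `ph` -/
def patternBlock {X : Type*} (S : List X) (d : X) (ph n : ℕ) : List X :=
  (List.range n).map fun j => S.getD ((ph + j) % S.length) d

/-- the state of the sequence interleaving algorithm: `k` is the pointer into the
diagonal index sequence, `used i` is the number of terms already removed from input
sequence `i`, and `flag` is `some (S, ph)` when the Boolean flag `P` is true with
current finite-fundamental string `S` and phase `ph`, and `none` when `P` is false. -/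
structure IState (X : Type*) where
  k : ℕ
  used : ℕ → ℕ
  flag : Option (List X × ℕ)

/-- one stage of the sequence interleaving algorithm: from state `s`, form block `B_l`
by removing `2^l` terms from the beginning of the unused part of input sequence
`idx s.k`, then check/update the periodicity flag, incrementing `k` exactly when the
flag ends up false.  Returns the new state together with the block produced. -/
def step {X : Type*} [DecidableEq X] (a : ℕ → ℕ → X) (s : IState X) (l : ℕ) :
    IState X × List X :=
  let i := idx s.k
  let B := (List.range (2 ^ l)).map fun j => a i (s.used i + 1 + j)
  let used' := fun i' => if i' = i then s.used i + 2 ^ l else s.used i'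
  match s.flag with
  | none =>
    match listPeriod? B with
    | some p => (⟨s.k, used', some (B.take p, 2 ^ l % p)⟩, B)
    | none => (⟨s.k + 1, used', none⟩, B)
  | some (S, ph) =>
    if B = patternBlock S (a 1 1) ph (2 ^ l) then
      (⟨s.k, used', some (S, (ph + 2 ^ l) % S.length)⟩, B)
    else (⟨s.k + 1, used', none⟩, B)

/-- `run a l` is the state of the interleaving algorithm after producing blocks
`B_1, …, B_l`, starting from `k = 1`, nothing used, and flag `P = false`. -/
def run {X : Type*} [DecidableEq X] (a : ℕ → ℕ → X) : ℕ → IState X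
  | 0 => ⟨1, fun _ => 0, none⟩
  | n + 1 => (step a (run a n) (n + 1)).1

/-- `block a l` is the block `B_l` (of length `2^l`) produced by the algorithm. -/
def block {X : Type*} [DecidableEq X] (a : ℕ → ℕ → X) (l : ℕ) : List X :=
  (step a (run a (l - 1)) l).2

/-- the output sequence of the sequence interleaving algorithm (1-indexed): the
concatenation `B_1 + B_2 + ⋯`, so position `n` lies in block `l = log₂ (n+1)`,
which occupies positions `2^l − 1` through `2^(l+1) − 2`. -/
def output {X : Type*} [DecidableEq X] (a : ℕ → ℕ → X) (n : ℕ) : X :=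
  (block a (Nat.log2 (n + 1))).getD (n + 1 - 2 ^ Nat.log2 (n + 1)) (a 1 1)

/-- a sequence (with relevant indices `≥ 1`) is eventually periodic -/
def EvPeriodic {X : Type*} (b : ℕ → X) : Prop :=
  ∃ m, 1 ≤ m ∧ ∃ r, ∀ n > r, b (n + m) = b n


section Helpers

variable {X : Type*} [DecidableEq X]

lemma two_tri (n : ℕ) : 2 * tri n = n * (n + 1) := by
  unfold tri
  exact Nat.mul_div_cancel' (Nat.even_mul_succ_self n).two_dvd

lemma idx_tri (n j : ℕ) (h : j ≤ n) : idx (tri n + j) = j + 1 := by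
  have h2 := two_tri n
  have h1 : 2 * n + 1 ≤ Nat.sqrt (8 * (tri n + j) + 1) := by
    rw [Nat.le_sqrt]; nlinarith
  have h3 : Nat.sqrt (8 * (tri n + j) + 1) < 2 * n + 3 := by
    rw [Nat.sqrt_lt]; nlinarith
  have h4 : (Nat.sqrt (8 * (tri n + j) + 1) - 1) / 2 = n := by omega
  unfold idx
  rw [h4]; omega

lemma idx_inf (i K : ℕ) (hi : 1 ≤ i) : ∃ k, K ≤ k ∧ idx k = i := by
  refine ⟨tri (K + i) + (i - 1), ?_, ?_⟩
  · have := two_tri (K + i)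
    nlinarith
  · rw [idx_tri _ _ (by omega)]; omega

lemma step_snd (a : ℕ → ℕ → X) (s : IState X) (l : ℕ) :
    (step a s l).2 = (List.range (2 ^ l)).map fun j => a (idx s.k) (s.used (idx s.k) + 1 + j) := by
  unfold step
  dsimp only
  split
  · split <;> rfl
  · split <;> rfl

lemma step_used (a : ℕ → ℕ → X) (s : IState X) (l i : ℕ) :
    (step a s l).1.used i = if i = idx s.k then s.used i + 2 ^ l else s.used i := by
  unfold step
  dsimp only
  split
  · split <;> (dsimp only; split_ifs with h <;> simp [h])
  · split <;> (dsimp only; split_ifs with h <;> simp [h])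

lemma step_k (a : ℕ → ℕ → X) (s : IState X) (l : ℕ) :
    (step a s l).1.k = s.k ∨ (step a s l).1.k = s.k + 1 := by
  unfold step
  dsimp only
  split
  · split <;> simp
  · split <;> simp

lemma listPeriod_pos (L : List X) (p : ℕ) (h : listPeriod? L = some p) :
    0 < p ∧ p < L.length := by
  unfold listPeriod? at h
  have h1 := List.find?_some h
  have h2 := List.mem_of_find?_eq_some h
  simp at h1 h2
  exact ⟨h1.1, h2⟩

lemma step_none (a : ℕ → ℕ → X) (s : IState X) (l : ℕ) (h : (step a s l).1.k = s.k)
    (hf : s.flag = none) :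
    ∃ S ph, 0 < S.length ∧ (step a s l).1.flag = some (S, ph) := by
  unfold step at h ⊢
  dsimp only at h ⊢
  rw [hf] at h ⊢
  dsimp only at h ⊢
  split
  · rename_i p hp
    have := listPeriod_pos _ _ hp
    refine ⟨_, _, ?_, rfl⟩
    rw [List.length_take]
    omega
  · rename_i hp
    rw [hp] at h
    simp at h

lemma step_some (a : ℕ → ℕ → X) (s : IState X) (l : ℕ) (h : (step a s l).1.k = s.k)
    (S : List X) (ph : ℕ) (hf : s.flag = some (S, ph)) :
    (step a s l).1.flag = some (S, (ph + 2 ^ l) % S.length) ∧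
    ∀ j < 2 ^ l, a (idx s.k) (s.used (idx s.k) + 1 + j) = S.getD ((ph + j) % S.length) (a 1 1) := by
  unfold step at h ⊢
  dsimp only at h ⊢
  rw [hf] at h ⊢
  dsimp only at h ⊢
  split_ifs at h ⊢ with hB
  · refine ⟨rfl, fun j hj => ?_⟩
    unfold patternBlock at hB
    rw [List.map_inj_left] at hB
    exact hB j (by simpa using hj)
  · simp at h

lemma step_inv (a : ℕ → ℕ → X) (s : IState X) (l : ℕ)
    (hs : ∀ S ph, s.flag = some (S, ph) → 0 < S.length) :
    ∀ S ph, (step a s l).1.flag = some (S, ph) → 0 < S.length := by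
  intro S ph h
  by_cases hk : (step a s l).1.k = s.k
  · rcases hf : s.flag with _ | ⟨S', ph'⟩
    · obtain ⟨S1, ph1, h1, h2⟩ := step_none a s l hk hf
      rw [h2] at h
      simp at h
      rw [← h.1]; exact h1
    · have h2 := (step_some a s l hk S' ph' hf).1
      rw [h2] at h
      simp at h
      rw [← h.1]; exact hs _ _ hf
  · exfalso
    unfold step at h hk
    dsimp only at h hk
    split at h
    · split at h <;> simp_all
    · split at h <;> simp_all

lemma run_inv (a : ℕ → ℕ → X) (n : ℕ) :
    ∀ S ph, (run a n).flag = some (S, ph) → 0 < S.length := by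
  induction n with
  | zero => intro S ph h; simp [run] at h
  | succ n ih => exact step_inv a _ _ ih

lemma run_k (a : ℕ → ℕ → X) (n : ℕ) :
    (run a (n + 1)).k = (run a n).k ∨ (run a (n + 1)).k = (run a n).k + 1 :=
  step_k a _ _

lemma run_used (a : ℕ → ℕ → X) (n i : ℕ) :
    (run a (n + 1)).used i = if i = idx (run a n).k then (run a n).used i + 2 ^ (n + 1)
      else (run a n).used i :=
  step_used a _ _ _

lemma run_k_mono (a : ℕ → ℕ → X) : Monotone fun n => (run a n).k :=
  monotone_nat_of_le_succ fun n => by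
    rcases run_k a n with h | h <;> simp [h]

lemma run_used_mono (a : ℕ → ℕ → X) (i : ℕ) : Monotone fun n => (run a n).used i :=
  monotone_nat_of_le_succ fun n => by
    have := run_used a n i
    split_ifs at this <;> simp [this]

lemma used_large (a : ℕ → ℕ → X) (i : ℕ) (h : ∀ N, ∃ l ≥ N, idx (run a l).k = i) (j : ℕ) :
    ∃ l, j ≤ (run a l).used i := by
  induction j with
  | zero => exact ⟨0, Nat.zero_le _⟩
  | succ j ih =>
    obtain ⟨l, hl⟩ := ih
    obtain ⟨m, hm, hi⟩ := h l
    refine ⟨m + 1, ?_⟩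
    rw [run_used, if_pos hi.symm]
    have h1 : (run a l).used i ≤ (run a m).used i := run_used_mono a i hm
    have h2 : 0 < 2 ^ (m + 1) := by positivity
    omega

lemma run_k_hits (a : ℕ → ℕ → X) (hub : ∀ K, ∃ l, K ≤ (run a l).k) (K : ℕ) (hK : 1 ≤ K) :
    ∃ l, (run a l).k = K := by
  classical
  have hs := Nat.find_spec (hub K)
  refine ⟨Nat.find (hub K), ?_⟩
  rcases hn : Nat.find (hub K) with _ | n
  · rw [hn] at hs
    simp [run] at hs ⊢
    omega
  · rw [hn] at hs
    have := Nat.find_min (hub K) (m := n) (by omega)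
    rcases run_k a n with h | h <;> omega

lemma stuck_periodic (a : ℕ → ℕ → X) (N K : ℕ) (h : ∀ l ≥ N, (run a l).k = K) :
    EvPeriodic (fun j => a (idx K) j) := by
  have hst : ∀ l ≥ N, (step a (run a l) (l + 1)).1.k = (run a l).k := fun l hl => by
    rw [h l hl]; exact h (l + 1) (by omega)
  obtain ⟨S, ph0, hS, hf0⟩ : ∃ S ph, 0 < S.length ∧ (run a (N + 1)).flag = some (S, ph) := by
    rcases hf : (run a N).flag with _ | ⟨S', ph'⟩
    · exact step_none a _ _ (hst N le_rfl) hf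
    · exact ⟨S', _, run_inv a N _ _ hf, (step_some a _ _ (hst N le_rfl) S' ph' hf).1⟩
  have key : ∀ m, ∃ t ph, (run a (N + 1 + m)).flag = some (S, ph) ∧
      (run a (N + 1 + m)).used (idx K) = (run a (N + 1)).used (idx K) + t ∧
      ph % S.length = (ph0 + t) % S.length ∧
      ∀ j < t, a (idx K) ((run a (N + 1)).used (idx K) + 1 + j)
        = S.getD ((ph0 + j) % S.length) (a 1 1) := by
    intro m
    induction m with
    | zero => exact ⟨0, ph0, hf0, rfl, rfl, fun j hj => absurd hj (by omega)⟩
    | succ m ih =>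
      obtain ⟨t, ph, h1, h2, h3, h4⟩ := ih
      have hk := h (N + 1 + m) (by omega)
      obtain ⟨g1, g2⟩ := step_some a _ _ (hst (N + 1 + m) (by omega)) S ph h1
      refine ⟨t + 2 ^ (N + 1 + m + 1), _, g1, ?_, ?_, ?_⟩
      · rw [← add_assoc, run_used, hk, if_pos rfl, h2, add_assoc]
      · rw [Nat.mod_mod, ← add_assoc]
        exact Nat.ModEq.add_right _ h3
      · intro j hj
        by_cases hjt : j < t
        · exact h4 j hjt
        · obtain ⟨j', rfl⟩ := Nat.exists_eq_add_of_le (not_lt.mp hjt)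
          have := g2 j' (by omega)
          rw [hk, h2] at this
          have e : (ph + j') % S.length = (ph0 + (t + j')) % S.length := by
            rw [← add_assoc]; exact Nat.ModEq.add_right _ h3
          rw [e] at this
          rw [← this]
          congr 1; omega
  have all : ∀ j, a (idx K) ((run a (N + 1)).used (idx K) + 1 + j)
        = S.getD ((ph0 + j) % S.length) (a 1 1) := by
    intro j
    obtain ⟨l, hl⟩ := used_large a (idx K)
      (fun M => ⟨max M N, le_max_left _ _, by rw [h _ (le_max_right _ _)]⟩)
      ((run a (N + 1)).used (idx K) + j + 1)
    obtain ⟨t, ph, h1, h2, h3, h4⟩ := key l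
    have : (run a l).used (idx K) ≤ (run a (N + 1 + l)).used (idx K) :=
      run_used_mono a _ (by omega)
    exact h4 j (by omega)
  refine ⟨S.length, hS, (run a (N + 1)).used (idx K), fun n hn => ?_⟩
  obtain ⟨j, rfl⟩ := Nat.exists_eq_add_of_le (Nat.succ_le_of_lt hn)
  have e1 := all j
  have e2 := all (j + S.length)
  rw [← add_assoc ph0, Nat.add_mod_right, ← e1, ← add_assoc] at e2
  exact e2

lemma visits (a : ℕ → ℕ → X) (i₀ : ℕ) (hi : 1 ≤ i₀)
    (huniq : ∀ i, 1 ≤ i → EvPeriodic (fun j => a i j) → i = i₀) :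
    ∀ N, ∃ l ≥ N, idx (run a l).k = i₀ := by
  intro N
  by_cases hub : ∀ K, ∃ l, K ≤ (run a l).k
  · obtain ⟨K, hK, hKi⟩ := idx_inf i₀ ((run a N).k + 1) hi
    obtain ⟨l, hl⟩ := run_k_hits a hub K (by omega)
    refine ⟨l, ?_, by rw [hl, hKi]⟩
    by_contra hlt
    have : (run a l).k ≤ (run a N).k := run_k_mono a (by omega)
    omega
  · push Not at hub
    classical
    obtain ⟨M, hM⟩ : ∃ M, ∀ l ≥ M, (run a l).k = (run a M).k := by
      by_contra hne
      push Not at hne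
      obtain ⟨K, hK⟩ := hub
      have : ∀ c, ∃ l, c ≤ (run a l).k := by
        intro c
        induction c with
        | zero => exact ⟨0, Nat.zero_le _⟩
        | succ c ih =>
          obtain ⟨l, hl⟩ := ih
          obtain ⟨m, hm, hmne⟩ := hne l
          have : (run a l).k ≤ (run a m).k := run_k_mono a hm
          exact ⟨m, by omega⟩
      obtain ⟨l, hl⟩ := this K
      have := hK l
      omega
    have hp := stuck_periodic a M _ hM
    have := huniq _ (by unfold idx; omega) hp
    exact ⟨max N M, le_max_left _ _, by rw [hM _ (le_max_right _ _), this]⟩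

lemma output_eq (a : ℕ → ℕ → X) (n t : ℕ) (ht : t < 2 ^ (n + 1)) :
    output a (2 ^ (n + 1) - 1 + t)
      = a (idx (run a n).k) ((run a n).used (idx (run a n).k) + 1 + t) := by
  have hpos : 0 < 2 ^ (n + 1) := by positivity
  have e : 2 ^ (n + 1) - 1 + t + 1 = 2 ^ (n + 1) + t := by omega
  have hlog : Nat.log2 (2 ^ (n + 1) + t) = n + 1 := by
    rw [Nat.log2_eq_iff (by omega)]
    rw [pow_succ 2 (n + 1)]
    omega
  unfold output block
  rw [e, hlog, step_snd]
  simp [List.getD, ht]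

end Helpers

/-- If exactly one input sequence `i₀` is eventually periodic, then the
output of the interleaving algorithm contains that input sequence in its entirety:
every term `a i₀ j` appears, in order, in the output sequence. -/
theorem stmt15 {X : Type*} [DecidableEq X] (a : ℕ → ℕ → X) (i₀ : ℕ) (hi : 1 ≤ i₀)
    (hp : EvPeriodic (fun j => a i₀ j))
    (huniq : ∀ i, 1 ≤ i → EvPeriodic (fun j => a i j) → i = i₀) :
    ∃ φ : ℕ → ℕ, StrictMono φ ∧ ∀ j, 1 ≤ j → output a (φ j) = a i₀ j := by
  classical
  have hu := used_large a i₀ (visits a i₀ hi huniq)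
  have hex : ∀ j, 1 ≤ j → ∃ n, (run a n).used i₀ < j ∧ j ≤ (run a (n + 1)).used i₀ := by
    intro j hj
    have hs := Nat.find_spec (hu j)
    rcases hn : Nat.find (hu j) with _ | n
    · rw [hn] at hs
      simp [run] at hs
      omega
    · rw [hn] at hs
      exact ⟨n, not_le.mp (Nat.find_min (hu j) (by omega)), hs⟩
  choose! L hL1 hL2 using hex
  have hidx : ∀ j, 1 ≤ j → i₀ = idx (run a (L j)).k := by
    intro j hj
    by_contra hne
    have h1 := hL1 j hj
    have h2 := hL2 j hj
    rw [run_used, if_neg hne] at h2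
    omega
  have hlt : ∀ j, 1 ≤ j → j - (run a (L j)).used i₀ - 1 < 2 ^ (L j + 1) := by
    intro j hj
    have h1 := hL1 j hj
    have h2 := hL2 j hj
    rw [run_used, if_pos (hidx j hj)] at h2
    omega
  refine ⟨fun j => if j = 0 then 0 else
    2 ^ (L j + 1) - 1 + (j - (run a (L j)).used i₀ - 1), ?_, ?_⟩
  · apply strictMono_nat_of_lt_succ
    intro j
    have hp2 : 2 ≤ 2 ^ (L (j + 1) + 1) := by
      rw [pow_succ]
      have : 0 < 2 ^ L (j + 1) := by positivity
      omega
    by_cases hj : j = 0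
    · subst hj
      simp only [if_true, zero_add] at hp2 ⊢
      simp only [one_ne_zero, if_false]
      omega
    · simp only [hj, if_false, Nat.succ_ne_zero]
      have hj1 : 1 ≤ j := by omega
      have a1 := hL1 j hj1
      have a2 := hL2 j hj1
      have b1 := hL1 (j + 1) (by omega)
      have b2 := hL2 (j + 1) (by omega)
      have c1 := hlt j hj1
      have hle : L j ≤ L (j + 1) := by
        by_contra hgt
        have : (run a (L (j + 1) + 1)).used i₀ ≤ (run a (L j)).used i₀ :=
          run_used_mono a i₀ (by omega)
        omega
      rcases hle.eq_or_lt with he | hl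
      · rw [← he] at b1 hp2 ⊢
        omega
      · have : 2 ^ (L j + 1 + 1) ≤ 2 ^ (L (j + 1) + 1) :=
          Nat.pow_le_pow_right (by norm_num) (by omega)
        rw [pow_succ 2 (L j + 1)] at this
        omega
  · intro j hj
    have hj0 : j ≠ 0 := by omega
    simp only [hj0, if_false]
    rw [output_eq a _ _ (hlt j hj), ← hidx j hj]
    have h1 := hL1 j hj
    congr 1
    omega
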